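/- arXiv:math/9801112 — 2 statements merged into one kernel-verified Lean document; each statement's English description precedes it below -/
import Mathlib

section
/- Let q, t be nonzero complex numbers and set p = q t^{−1}. The determinant of the deformed Cartan matrix C(q,t) of type E_7 equals p^7 + p^5 − p − p^{−1} + p^{−5} + p^{−7}. (This is the E_7 entry of the determinant table in Section 4 of the paper, used to evaluate the Kac determinant.) -/
/-- The (0-based) edges of the Dynkin diagram of `E_7` in Bourbaki numbering:
`{1,3}, {3,4}, {4,5}, {5,6}, {6,7}, {2,4}` (1-based). -/
def E7edges : List (ℕ × ℕ) := [(0, 2), (2, 3), (3, 4), (4, 5), (5, 6), (1, 3)]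

/-- The deformed Cartan matrix of type `E_7`: `(p + p⁻¹)·Id - A`, where `A` is the
adjacency matrix of the Dynkin diagram of `E_7`. -/
noncomputable def cartanE7 (p : ℂ) : Matrix (Fin 7) (Fin 7) ℂ :=
  Matrix.of fun i j =>
    (if i = j then p + p⁻¹ else 0) -
    (if ((i : ℕ), (j : ℕ)) ∈ E7edges ∨ ((j : ℕ), (i : ℕ)) ∈ E7edges then 1 else 0)

theorem E7det_aux (x : ℂ) :
    (!![x, 0, -1, 0, 0, 0, 0; 0, x, 0, -1, 0, 0, 0; -1, 0, x, -1, 0, 0, 0; 0, -1, -1, x, -1, 0, 0; 0, 0, 0, -1, x, -1, 0; 0, 0, 0, 0, -1, x, -1; 0, 0, 0, 0, 0, -1, x] : Matrix (Fin 7) (Fin 7) ℂ).det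
      = x ^ 7 - 6 * x ^ 5 + 9 * x ^ 3 - 3 * x := by
  simp [Matrix.det_succ_row_zero, Fin.sum_univ_succ, Fin.succAbove]
  ring

theorem cartanE7_eq_aux (p : ℂ) : cartanE7 p =
    (fun x : ℂ => !![x, 0, -1, 0, 0, 0, 0; 0, x, 0, -1, 0, 0, 0; -1, 0, x, -1, 0, 0, 0; 0, -1, -1, x, -1, 0, 0; 0, 0, 0, -1, x, -1, 0; 0, 0, 0, 0, -1, x, -1; 0, 0, 0, 0, 0, -1, x]) (p + p⁻¹) := by
  ext i j
  fin_cases i <;> fin_cases j <;> simp [cartanE7, E7edges]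

/-- The `E_7` entry of the determinant table in Section 4 of the paper:
`det C(q,t) = p^7 + p^5 - p - p⁻¹ + p^{-5} + p^{-7}`, where `p = q t⁻¹`. -/
theorem stmt14 (q t : ℂ) (hq : q ≠ 0) (ht : t ≠ 0) :
    (cartanE7 (q * t⁻¹)).det =
      (q * t⁻¹) ^ 7 + (q * t⁻¹) ^ 5 - (q * t⁻¹) - (q * t⁻¹)⁻¹ +
        ((q * t⁻¹)⁻¹) ^ 5 + ((q * t⁻¹)⁻¹) ^ 7 := by
  have hp : q * t⁻¹ ≠ 0 := mul_ne_zero hq (inv_ne_zero ht)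
  generalize q * t⁻¹ = p at hp ⊢
  rw [cartanE7_eq_aux]
  simp only [E7det_aux]
  field_simp
  ring
end

section
/- Let q, t be nonzero complex numbers and set p = q t^{−1}. The determinant of the deformed Cartan matrix C(q,t) of type E_8 equals p^8 + p^6 − p^2 − 1 − p^{−2} + p^{−6} + p^{−8}, i.e. det C(q,t) = p^{−8}·Φ_{30}(p²), where Φ_{30}(y) = y^8 + y^7 − y^5 − y^4 − y^3 + y + 1 is the 30th cyclotomic polynomial. (This is the E_8 entry of the determinant table in Section 4 of the paper, with the constant term corrected so that the value at p = 1 equals det of the classical E_8 Cartan matrix, namely 1.) -/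
/-- The (0-based) edges of the Dynkin diagram of `E_8` in Bourbaki numbering:
`{1,3}, {3,4}, {4,5}, {5,6}, {6,7}, {7,8}, {2,4}` (1-based). -/
def E8edges : List (ℕ × ℕ) := [(0, 2), (2, 3), (3, 4), (4, 5), (5, 6), (6, 7), (1, 3)]

/-- The deformed Cartan matrix of type `E_8`: `(p + p⁻¹)·Id - A`, where `A` is the
adjacency matrix of the Dynkin diagram of `E_8`. -/
noncomputable def cartanE8 (p : ℂ) : Matrix (Fin 8) (Fin 8) ℂ :=
  Matrix.of fun i j =>
    (if i = j then p + p⁻¹ else 0) -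
    (if ((i : ℕ), (j : ℕ)) ∈ E8edges ∨ ((j : ℕ), (i : ℕ)) ∈ E8edges then 1 else 0)

set_option maxHeartbeats 8000000 in
/-- The characteristic polynomial of the `E_8` Dynkin diagram, as an explicit determinant. -/
theorem det_E8_aux (x : ℂ) :
    (!![x, 0, -1, 0, 0, 0, 0, 0;
        0, x, 0, -1, 0, 0, 0, 0;
        -1, 0, x, -1, 0, 0, 0, 0;
        0, -1, -1, x, -1, 0, 0, 0;
        0, 0, 0, -1, x, -1, 0, 0;
        0, 0, 0, 0, -1, x, -1, 0;
        0, 0, 0, 0, 0, -1, x, -1;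
        0, 0, 0, 0, 0, 0, -1, x] : Matrix (Fin 8) (Fin 8) ℂ).det =
      x ^ 8 - 7 * x ^ 6 + 14 * x ^ 4 - 8 * x ^ 2 + 1 := by
  rw [Matrix.det_succ_row_zero]
  simp [Fin.sum_univ_succ, Fin.succAbove, Matrix.submatrix]
  simp only [Matrix.det_succ_row_zero (n := 6)]
  simp [Fin.sum_univ_succ, Fin.succAbove, Matrix.submatrix]
  simp only [Matrix.det_succ_row_zero (n := 5)]
  simp [Fin.sum_univ_succ, Fin.succAbove, Matrix.submatrix]
  simp only [Matrix.det_succ_row_zero (n := 4)]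
  simp [Fin.sum_univ_succ, Fin.succAbove, Matrix.submatrix]
  simp only [Matrix.det_succ_row_zero (n := 3)]
  simp [Fin.sum_univ_succ, Fin.succAbove, Matrix.submatrix]
  simp [Matrix.det_succ_row_zero, Fin.sum_univ_succ, Fin.succAbove, Matrix.submatrix]
  ring

theorem cartanE8_det (p : ℂ) :
    (cartanE8 p).det = (p + p⁻¹) ^ 8 - 7 * (p + p⁻¹) ^ 6 + 14 * (p + p⁻¹) ^ 4
      - 8 * (p + p⁻¹) ^ 2 + 1 := by
  rw [← det_E8_aux]
  congr 1
  ext i j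
  fin_cases i <;> fin_cases j <;> simp [cartanE8, E8edges]

/-- The `E_8` entry of the determinant table in Section 4 of the paper (with the constant
term corrected): `det C(q,t) = p^8 + p^6 - p^2 - 1 - p^{-2} + p^{-6} + p^{-8}`, i.e.
`det C(q,t) = p^{-8}·Φ₃₀(p²)` with `Φ₃₀(y) = y^8 + y^7 - y^5 - y^4 - y^3 + y + 1` the
30th cyclotomic polynomial, where `p = q t⁻¹`. -/
theorem stmt15 (q t : ℂ) (hq : q ≠ 0) (ht : t ≠ 0) :
    (cartanE8 (q * t⁻¹)).det =
      (q * t⁻¹) ^ 8 + (q * t⁻¹) ^ 6 - (q * t⁻¹) ^ 2 - 1 - ((q * t⁻¹)⁻¹) ^ 2 +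
        ((q * t⁻¹)⁻¹) ^ 6 + ((q * t⁻¹)⁻¹) ^ 8 ∧
    (cartanE8 (q * t⁻¹)).det =
      ((q * t⁻¹)⁻¹) ^ 8 *
        (((q * t⁻¹) ^ 2) ^ 8 + ((q * t⁻¹) ^ 2) ^ 7 - ((q * t⁻¹) ^ 2) ^ 5 -
          ((q * t⁻¹) ^ 2) ^ 4 - ((q * t⁻¹) ^ 2) ^ 3 + (q * t⁻¹) ^ 2 + 1) := by
  have hp : q * t⁻¹ ≠ 0 := mul_ne_zero hq (inv_ne_zero ht)
  rw [cartanE8_det]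
  generalize q * t⁻¹ = p at hp
  constructor
  · field_simp
    ring
  · field_simp
    ring
end
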